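/- For every c > 0, the function ψ(x) := (1/2)·log(1+x) + log(1 + φ(x)/c²), where φ(x) = (arsinh √x)² = log²(√x + √(1+x)), is a Bernstein function: ψ(0) = 0, ψ ≥ 0 on [0,∞), ψ is smooth on (0,∞), and (−1)^{n−1} ψ^{(n)}(x) ≥ 0 for all n ≥ 1 and x > 0. Consequently the distribution whose Laplace transform is exp(−ψ) (the law of the size-biased inverse exponential functional X_{1,c}) is infinitely divisible. -/

import Mathlib

open Real MeasureTheory
open Set Filter Topology
open scoped ContDiff Nat

/-- The derivatives of `f` up to order `N` exist, are continuous and alternate in sign on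
`(0, ∞)`, starting with `0 ≤ f`. -/
structure CompletelyMonotoneUpTo (N : ℕ) (f : ℝ → ℝ) : Prop where
  contDiffOn : ContDiffOn ℝ N f (Ioi 0)
  nonneg : ∀ n ≤ N, ∀ x, 0 < x → 0 ≤ (-1 : ℝ) ^ n * iteratedDeriv n f x

/-- A function is completely monotone on `(0, ∞)` if all its derivatives alternate in sign. -/
def CompletelyMonotone (f : ℝ → ℝ) : Prop := ∀ N, CompletelyMonotoneUpTo N f

namespace CompletelyMonotoneUpTo

variable {N : ℕ} {f g : ℝ → ℝ}

theorem contDiffAt (hf : CompletelyMonotoneUpTo N f) {x : ℝ} (hx : 0 < x) {n : ℕ} (hn : n ≤ N) :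
    ContDiffAt ℝ n f x :=
  ((hf.contDiffOn x hx).contDiffAt (Ioi_mem_nhds hx)).of_le (by exact_mod_cast hn)

theorem zero_iff : CompletelyMonotoneUpTo 0 f ↔ ContinuousOn f (Ioi 0) ∧ ∀ x, 0 < x → 0 ≤ f x := by
  refine ⟨fun h => ⟨h.contDiffOn.continuousOn, fun x hx => by simpa using h.nonneg 0 le_rfl x hx⟩,
    fun h => ⟨by simpa using h.1, fun n hn x hx => ?_⟩⟩
  obtain rfl : n = 0 := by lia
  simpa using h.2 x hx

theorem congr (hf : CompletelyMonotoneUpTo N f) (hfg : EqOn g f (Ioi 0)) :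
    CompletelyMonotoneUpTo N g := by
  refine ⟨hf.contDiffOn.congr hfg, fun n hn x hx => ?_⟩
  have h : g =ᶠ[𝓝 x] f := hfg.eventuallyEq_of_mem (Ioi_mem_nhds hx)
  rw [h.iteratedDeriv_eq]
  exact hf.nonneg n hn x hx

theorem add (hf : CompletelyMonotoneUpTo N f) (hg : CompletelyMonotoneUpTo N g) :
    CompletelyMonotoneUpTo N (f + g) := by
  refine ⟨hf.contDiffOn.add hg.contDiffOn, fun n hn x hx => ?_⟩
  rw [iteratedDeriv_add (hf.contDiffAt hx hn) (hg.contDiffAt hx hn), mul_add]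
  exact add_nonneg (hf.nonneg n hn x hx) (hg.nonneg n hn x hx)

theorem mul (hf : CompletelyMonotoneUpTo N f) (hg : CompletelyMonotoneUpTo N g) :
    CompletelyMonotoneUpTo N (f * g) := by
  refine ⟨hf.contDiffOn.mul hg.contDiffOn, fun n hn x hx => ?_⟩
  rw [iteratedDeriv_mul (hf.contDiffAt hx hn) (hg.contDiffAt hx hn), Finset.mul_sum]
  refine Finset.sum_nonneg fun i hi => ?_
  have hi' : i ≤ n := by simpa [Nat.lt_succ_iff] using hi
  have h := mul_nonneg (hf.nonneg i (hi'.trans hn) x hx)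
    (hg.nonneg (n - i) ((Nat.sub_le _ _).trans hn) x hx)
  have hpow : (-1 : ℝ) ^ n = (-1) ^ i * (-1) ^ (n - i) := by
    rw [← pow_add, Nat.add_sub_cancel' hi']
  rw [hpow]
  calc (0 : ℝ) ≤ (n.choose i : ℝ) * _ := mul_nonneg (Nat.cast_nonneg _) h
    _ = _ := by ring

theorem const {r : ℝ} (hr : 0 ≤ r) : CompletelyMonotoneUpTo N (fun _ => r) := by
  refine ⟨contDiffOn_const, fun n _ x _ => ?_⟩
  rw [iteratedDeriv_const]
  split_ifs with h
  · simpa [h] using hr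
  · simp

theorem succ_of_hasDerivAt (hg : CompletelyMonotoneUpTo N g) (hf : ∀ x, 0 < x → 0 ≤ f x)
    (hd : ∀ x, 0 < x → HasDerivAt f (-g x) x) : CompletelyMonotoneUpTo (N + 1) f := by
  have heq : EqOn (deriv f) (-g) (Ioi 0) := fun x hx => (hd x hx).deriv
  refine ⟨?_, fun n hn x hx => ?_⟩
  · push_cast
    rw [contDiffOn_succ_iff_deriv_of_isOpen isOpen_Ioi]
    exact ⟨fun x hx => (hd x hx).differentiableAt.differentiableWithinAt, by simp,
      hg.contDiffOn.neg.congr heq⟩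
  · cases n with
    | zero => simpa using hf x hx
    | succ n =>
      have h : deriv f =ᶠ[𝓝 x] -g := heq.eventuallyEq_of_mem (Ioi_mem_nhds hx)
      rw [iteratedDeriv_succ', h.iteratedDeriv_eq, iteratedDeriv_neg, pow_succ]
      simpa using hg.nonneg n (by lia) x hx

end CompletelyMonotoneUpTo

namespace CompletelyMonotone

variable {f g : ℝ → ℝ}

theorem nonneg (hf : CompletelyMonotone f) {x : ℝ} (hx : 0 < x) : 0 ≤ f x := by
  simpa using (hf 0).nonneg 0 le_rfl x hx

theorem contDiffAt (hf : CompletelyMonotone f) {x : ℝ} (hx : 0 < x) (n : ℕ) :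
    ContDiffAt ℝ n f x :=
  (hf n).contDiffAt hx le_rfl

/-- A positive function whose derivative is completely monotone has a completely monotone
reciprocal. -/
theorem inv (hg : CompletelyMonotone g) (hf : ∀ x, 0 < x → 0 < f x)
    (hd : ∀ x, 0 < x → HasDerivAt f (g x) x) : CompletelyMonotone fun x => (f x)⁻¹ := by
  intro N
  have hpos : ∀ x, 0 < x → 0 ≤ (f x)⁻¹ := fun x hx => (inv_pos.2 (hf x hx)).le
  induction N with
  | zero =>
    exact CompletelyMonotoneUpTo.zero_iff.2
      ⟨fun x hx => ((hd x hx).continuousAt.inv₀ (hf x hx).ne').continuousWithinAt, hpos⟩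
  | succ N ih =>
    refine ((hg N).mul (ih.mul ih)).succ_of_hasDerivAt hpos fun x hx => ?_
    refine ((hd x hx).inv (hf x hx).ne').congr_deriv ?_
    have := (hf x hx).ne'
    change -g x / f x ^ 2 = -(g x * ((f x)⁻¹ * (f x)⁻¹))
    field_simp

/-- The exponential of the opposite of a function with completely monotone derivative is
completely monotone. -/
theorem exp_neg (hg : CompletelyMonotone g) (hd : ∀ x, 0 < x → HasDerivAt f (g x) x) :
    CompletelyMonotone fun x => Real.exp (-f x) := by
  intro N
  induction N with
  | zero =>
    exact CompletelyMonotoneUpTo.zero_iff.2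
      ⟨fun x hx => (hd x hx).neg.exp.continuousAt.continuousWithinAt, fun x _ => (exp_pos _).le⟩
  | succ N ih =>
    refine ((hg N).mul ih).succ_of_hasDerivAt (fun x _ => (exp_pos _).le) fun x hx => ?_
    refine (hd x hx).neg.exp.congr_deriv ?_
    change Real.exp (-f x) * -g x = -(g x * Real.exp (-f x))
    ring

theorem taylorWithinEval_eq (hf : CompletelyMonotone f) {a b : ℝ} (hb : 0 < b) (hab : b < a)
    (n : ℕ) :
    taylorWithinEval f n (uIcc a b) a b =
      ∑ k ∈ Finset.range (n + 1), (-1) ^ k * iteratedDeriv k f a * (a - b) ^ k / k ! := by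
  rw [taylor_within_apply]
  refine Finset.sum_congr rfl fun k _ => ?_
  rw [iteratedDerivWithin_eq_iteratedDeriv (uniqueDiffOn_uIcc hab.ne')
    (hf.contDiffAt (hb.trans hab) k) left_mem_uIcc, ← neg_sub a b, neg_pow, smul_eq_mul]
  ring

/-- Taylor polynomials of a completely monotone function are lower bounds to the left of their
centre. -/
theorem sum_taylor_le (hf : CompletelyMonotone f) {a b : ℝ} (hb : 0 < b) (hab : b < a) (n : ℕ) :
    ∑ k ∈ Finset.range (n + 1), (-1) ^ k * iteratedDeriv k f a * (a - b) ^ k / k ! ≤ f b := by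
  have hsub : uIcc a b ⊆ Ioi 0 := by
    rw [uIcc_of_ge hab.le]; exact fun y hy => hb.trans_le hy.1
  obtain ⟨y, hy, h⟩ := taylor_mean_remainder_lagrange_iteratedDeriv (n := n) hab.ne'
    (by exact_mod_cast (hf (n + 1)).contDiffOn.mono hsub)
  rw [hf.taylorWithinEval_eq hb hab] at h
  have hD := (hf (n + 1)).nonneg (n + 1) le_rfl y (hsub (uIoo_subset_uIcc_self hy))
  have hR : 0 ≤ iteratedDeriv (n + 1) f y * (b - a) ^ (n + 1) / (n + 1)! := by
    rw [← neg_sub a b, neg_pow, ← mul_assoc, mul_comm (iteratedDeriv (n + 1) f y)]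
    have := sub_pos.2 hab
    positivity
  linarith

theorem taylor_term_nonneg (hf : CompletelyMonotone f) {a b : ℝ} (ha : 0 < a) (hab : b ≤ a)
    (k : ℕ) : 0 ≤ (-1) ^ k * iteratedDeriv k f a * (a - b) ^ k / k ! := by
  have h1 := (hf k).nonneg k le_rfl a ha
  have h2 := sub_nonneg.2 hab
  positivity

/-- A completely monotone function is the sum of its Taylor series to the left of the centre. -/
theorem hasSum_taylor (hf : CompletelyMonotone f) {a b : ℝ} (hb : 0 < b) (hab : b < a) :
    HasSum (fun k : ℕ => (-1) ^ k * iteratedDeriv k f a * (a - b) ^ k / k !) (f b) := by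
  rw [hasSum_iff_tendsto_nat_of_nonneg (hf.taylor_term_nonneg (hb.trans hab) hab.le),
    ← tendsto_add_atTop_iff_nat 1]
  have hsub : uIcc a b ⊆ Ioi 0 := by
    rw [uIcc_of_ge hab.le]; exact fun y hy => hb.trans_le hy.1
  set q : ℝ := (a - b) / (a - b / 2) with hq
  have hq0 : 0 ≤ q := div_nonneg (by linarith) (by linarith)
  have hq1 : q < 1 := (div_lt_one (by linarith)).2 (by linarith)
  set C : ℝ := (a - b) * f (b / 2) / (b / 2) with hC
  have hbound : ∀ n : ℕ, f b - C * ((n + 1) * q ^ n) ≤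
      ∑ k ∈ Finset.range (n + 1), (-1) ^ k * iteratedDeriv k f a * (a - b) ^ k / k ! := by
    intro n
    have hcd : ContDiffOn ℝ (n + 1 : ℕ) f (uIcc a b) := (hf (n + 1)).contDiffOn.mono hsub
    obtain ⟨y, hy, h⟩ := taylor_mean_remainder_cauchy (n := n) hab.ne'
      (hcd.of_le (by exact_mod_cast n.le_succ))
      ((hcd.differentiableOn_iteratedDerivWithin (by exact_mod_cast n.lt_succ_self)
        (uniqueDiffOn_uIcc hab.ne')).mono uIoo_subset_uIcc_self)
    have hy' := uIoo_subset_uIcc_self hy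
    rw [hf.taylorWithinEval_eq hb hab, iteratedDerivWithin_eq_iteratedDeriv
      (uniqueDiffOn_uIcc hab.ne') (hf.contDiffAt (hsub hy') _) hy'] at h
    rw [uIoo_of_ge hab.le] at hy
    have hterm : (-1) ^ (n + 1) * iteratedDeriv (n + 1) f y * (y - b / 2) ^ (n + 1) / (n + 1)! ≤
        f (b / 2) := by
      refine le_trans ?_ (hf.sum_taylor_le (a := y) (half_pos hb) (by linarith [hy.1]) (n + 1))
      exact Finset.single_le_sum (f := fun k : ℕ =>
        (-1) ^ k * iteratedDeriv k f y * (y - b / 2) ^ k / k !)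
        (fun k _ => hf.taylor_term_nonneg (hb.trans hy.1) (by linarith [hy.1]) k)
        (Finset.mem_range.2 (Nat.lt_succ_self _))
    have hD := (hf (n + 1)).nonneg (n + 1) le_rfl y (hb.trans hy.1)
    set D := (-1) ^ (n + 1) * iteratedDeriv (n + 1) f y with hDdef
    have hR : iteratedDeriv (n + 1) f y * (b - y) ^ n / n ! * (b - a) =
        D * (y - b) ^ n / n ! * (a - b) := by
      rw [hDdef, ← neg_sub y b, neg_pow, pow_succ]; ring
    have hyb : 0 < y - b / 2 := by linarith [hy.1]
    have hratio : (y - b) / (y - b / 2) ≤ q := by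
      rw [hq, div_le_div_iff₀ hyb (by linarith)]
      nlinarith [hy.2]
    have hratio0 : 0 ≤ (y - b) / (y - b / 2) := div_nonneg (by linarith [hy.1]) hyb.le
    have hfb : 0 ≤ f (b / 2) := hf.nonneg (half_pos hb)
    have key : D * (y - b) ^ n / n ! * (a - b) ≤ C * ((n + 1) * q ^ n) := by
      calc D * (y - b) ^ n / n ! * (a - b)
          = (D * (y - b / 2) ^ (n + 1) / (n + 1)!) * (((y - b) / (y - b / 2)) ^ n *
            ((n + 1) * (a - b) / (y - b / 2))) := by
            rw [Nat.factorial_succ, div_pow, pow_succ]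
            generalize y - b / 2 = e at hyb
            push_cast
            field_simp
        _ ≤ f (b / 2) * (q ^ n * ((n + 1) * (a - b) / (b / 2))) := by
            have : (0 : ℝ) ≤ (n + 1) * (a - b) := mul_nonneg (by positivity) (by linarith)
            have : b / 2 ≤ y - b / 2 := by linarith [hy.1]
            gcongr
        _ = C * ((n + 1) * q ^ n) := by rw [hC]; ring
    rw [hR] at h
    linarith
  refine tendsto_of_tendsto_of_tendsto_of_le_of_le (g := fun n : ℕ => f b - C * ((n + 1) * q ^ n))
    (h := fun _ => f b) ?_ tendsto_const_nhds hbound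
    (fun n => hf.sum_taylor_le hb hab n)
  have h1 := (tendsto_self_mul_const_pow_of_lt_one hq0 hq1).add
    (tendsto_pow_atTop_nhds_zero_of_lt_one hq0 hq1)
  have h2 := (h1.const_mul C).const_sub (f b)
  simp only [add_zero, mul_zero, sub_zero] at h2
  exact h2.congr fun n => by ring

/-- The Taylor series of a completely monotone function converges to the boundary value `f 0`. -/
theorem hasSum_taylor_zero (hf : CompletelyMonotone f) (h0 : Tendsto f (𝓝[>] 0) (𝓝 (f 0)))
    {a : ℝ} (ha : 0 < a) :
    HasSum (fun k : ℕ => (-1) ^ k * iteratedDeriv k f a * a ^ k / k !) (f 0) := by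
  have hnn : ∀ k : ℕ, 0 ≤ (-1) ^ k * iteratedDeriv k f a * a ^ k / k ! := fun k => by
    simpa using hf.taylor_term_nonneg ha ha.le k (b := 0)
  have hlt : ∀ᶠ b in 𝓝[>] (0 : ℝ), 0 < b ∧ b < a :=
    (eventually_mem_nhdsWithin).and (eventually_nhdsWithin_of_eventually_nhds (Iio_mem_nhds ha))
  have hpart : ∀ n : ℕ, ∑ k ∈ Finset.range n, (-1) ^ k * iteratedDeriv k f a * a ^ k / k ! ≤
      f 0 := by
    intro n
    have hc : Tendsto (fun b : ℝ => ∑ k ∈ Finset.range n,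
        (-1) ^ k * iteratedDeriv k f a * (a - b) ^ k / k !) (𝓝[>] 0)
        (𝓝 (∑ k ∈ Finset.range n, (-1) ^ k * iteratedDeriv k f a * (a - 0) ^ k / k !)) :=
      (Continuous.tendsto (by fun_prop) 0).mono_left nhdsWithin_le_nhds
    rw [sub_zero] at hc
    refine le_of_tendsto_of_tendsto hc h0 ?_
    filter_upwards [hlt] with b hb
    refine (hf.sum_taylor_le hb.1 hb.2 n).trans' ?_
    rw [Finset.sum_range_succ]
    exact le_add_of_nonneg_right (hf.taylor_term_nonneg ha hb.2.le n)
  have hsum := summable_of_sum_range_le hnn hpart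
  refine hsum.hasSum_iff.2 (le_antisymm (hsum.tsum_le_of_sum_range_le hpart) ?_)
  refine le_of_tendsto h0 ?_
  filter_upwards [hlt] with b hb
  rw [← (hf.hasSum_taylor hb.1 hb.2).tsum_eq]
  refine (hf.hasSum_taylor hb.1 hb.2).summable.tsum_le_tsum (fun k => ?_) hsum
  have h1 := (hf k).nonneg k le_rfl a ha
  have h2 : 0 ≤ a - b := by linarith [hb.2]
  have h3 : a - b ≤ a := by linarith [hb.1]
  gcongr

end CompletelyMonotone

/-- **Uniqueness of Laplace transforms**: two finite measures whose Laplace transforms exist and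
agree on `[0, ∞)` are equal. -/
theorem MeasureTheory.Measure.ext_of_laplace_eq {μ ν : Measure ℝ} [IsFiniteMeasure μ]
    [IsFiniteMeasure ν] (hμ : ∀ x, 0 ≤ x → Integrable (fun y => Real.exp (-x * y)) μ)
    (hν : ∀ x, 0 ≤ x → Integrable (fun y => Real.exp (-x * y)) ν)
    (h : ∀ x, 0 ≤ x → ∫ y, Real.exp (-x * y) ∂μ = ∫ y, Real.exp (-x * y) ∂ν) : μ = ν := by
  have hint : ∀ ρ : Measure ℝ, (∀ x, 0 ≤ x → Integrable (fun y => Real.exp (-x * y)) ρ) →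
      Iio 0 ⊆ interior (ProbabilityTheory.integrableExpSet id ρ) := by
    intro ρ hρ
    refine interior_maximal (fun t ht => ?_) isOpen_Iio
    simpa [ProbabilityTheory.integrableExpSet] using hρ (-t) (neg_nonneg.2 (le_of_lt ht))
  have han : ∀ ρ : Measure ℝ, (∀ x, 0 ≤ x → Integrable (fun y => Real.exp (-x * y)) ρ) →
      AnalyticOnNhd ℂ (ProbabilityTheory.complexMGF id ρ) {z | z.re < 0} := fun ρ hρ z hz =>
    ProbabilityTheory.analyticOnNhd_complexMGF z (hint ρ hρ hz)
  have heq : EqOn (ProbabilityTheory.complexMGF id μ) (ProbabilityTheory.complexMGF id ν)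
      {z | z.re < 0} := by
    refine (han μ hμ).eqOn_of_preconnected_of_frequently_eq (han ν hν)
      (convex_halfSpace_re_lt 0).isPreconnected (z₀ := ((-1 : ℝ) : ℂ)) (by simp) ?_
    have hreal : ∃ᶠ x : ℝ in 𝓝[≠] (-1), ProbabilityTheory.complexMGF id μ x =
        ProbabilityTheory.complexMGF id ν x := by
      refine Eventually.frequently (eventually_nhdsWithin_of_eventually_nhds ?_)
      filter_upwards [Iio_mem_nhds (show (-1 : ℝ) < 0 by norm_num)] with x hx
      rw [ProbabilityTheory.complexMGF_ofReal, ProbabilityTheory.complexMGF_ofReal]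
      simpa [ProbabilityTheory.mgf] using h (-x) (neg_nonneg.2 (le_of_lt hx))
    refine Tendsto.frequently (f := fun x : ℝ => (x : ℂ)) ?_ hreal
    exact Complex.continuous_ofReal.continuousWithinAt.tendsto_nhdsWithin fun x hx => by
      simpa using Complex.ofReal_injective.ne hx
  have hlim : ∀ ρ : Measure ℝ, IsFiniteMeasure ρ →
      (∀ x, 0 ≤ x → Integrable (fun y => Real.exp (-x * y)) ρ) → ∀ t : ℝ,
      Tendsto (fun n : ℕ => ProbabilityTheory.complexMGF id ρ
        (((-(1 / ((n : ℝ) + 1)) : ℝ) : ℂ) + t * Complex.I)) atTop (𝓝 (charFun ρ t)) := by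
    intro ρ _ hρ t
    rw [← ProbabilityTheory.complexMGF_id_mul_I]
    refine tendsto_integral_of_dominated_convergence (fun y => 1 + Real.exp (-1 * y)) (fun n => ?_)
      ((integrable_const 1).add (hρ 1 zero_le_one)) (fun n => ?_) ?_
    · exact Continuous.aestronglyMeasurable (by fun_prop)
    · refine ae_of_all _ fun y => ?_
      have hn : 0 ≤ 1 / ((n : ℝ) + 1) := by positivity
      have hn1 : 1 / ((n : ℝ) + 1) ≤ 1 := by
        rw [div_le_one (by positivity)]; linarith [n.cast_nonneg (α := ℝ)]
      rw [Complex.norm_exp]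
      simp only [id, Complex.mul_re, Complex.add_re, Complex.ofReal_re, Complex.I_re,
        Complex.add_im, Complex.ofReal_im, Complex.mul_im, Complex.I_im, mul_zero, mul_one,
        sub_zero, add_zero]
      rcases le_total 0 y with hy | hy
      · have : Real.exp (-(1 / ((n : ℝ) + 1)) * y) ≤ 1 :=
          Real.exp_le_one_iff.2 (by nlinarith)
        linarith [Real.exp_pos (-1 * y)]
      · have : Real.exp (-(1 / ((n : ℝ) + 1)) * y) ≤ Real.exp (-1 * y) :=
          Real.exp_le_exp.2 (by nlinarith)
        linarith
    · refine ae_of_all _ fun y => ?_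
      have hc : Continuous fun s : ℝ =>
          Complex.exp ((((-s : ℝ) : ℂ) + t * Complex.I) * (id y : ℝ)) := by
        fun_prop
      have := (hc.tendsto 0).comp (tendsto_one_div_add_atTop_nhds_zero_nat (𝕜 := ℝ))
      simpa [Function.comp_def] using this
  refine Measure.ext_of_charFun (funext fun t => ?_)
  refine tendsto_nhds_unique (hlim μ inferInstance hμ t)
    ((hlim ν inferInstance hν t).congr fun n => (heq ?_).symm)
  have hn : (0 : ℝ) < 1 / ((n : ℝ) + 1) := by positivity
  rw [mem_ofPred_eq, Complex.add_re, Complex.ofReal_re]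
  simpa using hn

/-- A probability measure on `[0, 1]` representing `f` through `∫ u ^ x` pushes forward under
`-log` to a measure with Laplace transform `f`. -/
theorem exists_laplace_of_unitInterval {f : ℝ → ℝ} (hf0 : f 0 = 1)
    (h0 : Tendsto f (𝓝[>] 0) (𝓝 (f 0))) (Q : Measure unitInterval) [IsProbabilityMeasure Q]
    (hQ : ∀ x, 0 < x → ∫ u : unitInterval, (u : ℝ) ^ x ∂Q = f x) :
    ∃ ν : Measure ℝ, IsProbabilityMeasure ν ∧ ∀ x, 0 ≤ x →
      Integrable (fun y => Real.exp (-x * y)) ν ∧ ∫ y, Real.exp (-x * y) ∂ν = f x := by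
  have hpos : ∀ᵐ u : unitInterval ∂Q, (0 : ℝ) < u := by
    have hle : ∀ x, 0 < x → f x ≤ Q.real {0}ᶜ := by
      intro x hx
      rw [← hQ x hx, ← integral_indicator_one (measurableSet_singleton _).compl]
      refine integral_mono_of_nonneg (ae_of_all _ fun u => Real.rpow_nonneg u.2.1 x)
        ((integrable_const 1).indicator (measurableSet_singleton _).compl)
        (ae_of_all _ fun u => ?_)
      by_cases hu : u = 0
      · simp [hu, Real.zero_rpow hx.ne']
      · simpa [hu] using Real.rpow_le_one u.2.1 u.2.2 hx.le
    have h1 : 1 ≤ Q.real {0}ᶜ := hf0 ▸ le_of_tendsto h0 (eventually_mem_nhdsWithin.mono hle)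
    have h2 : Q {0} = 0 := by
      rw [probReal_compl_eq_one_sub (measurableSet_singleton _)] at h1
      have : Q.real {0} = 0 := le_antisymm (by linarith) measureReal_nonneg
      simpa [measureReal_eq_zero_iff] using this
    filter_upwards [measure_eq_zero_iff_ae_notMem.1 h2] with u hu
    exact lt_of_le_of_ne u.2.1 fun h => hu (Subtype.ext h.symm)
  have hm : Measurable fun u : unitInterval => -Real.log u := by fun_prop
  refine ⟨Q.map fun u : unitInterval => -Real.log u,
    Measure.isProbabilityMeasure_map hm.aemeasurable, fun x hx => ?_⟩
  have hexp : (fun u : unitInterval => Real.exp (-x * -Real.log u)) =ᵐ[Q]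
      fun u => (u : ℝ) ^ x := by
    filter_upwards [hpos] with u hu
    rw [Real.rpow_def_of_pos hu]
    ring_nf
  constructor
  · rw [integrable_map_measure (by fun_prop) hm.aemeasurable]
    refine Integrable.congr (Integrable.of_bound (C := 1) ?_ (ae_of_all _ fun u => ?_)) hexp.symm
    · exact Measurable.aestronglyMeasurable (by fun_prop)
    · rw [Real.norm_of_nonneg (Real.rpow_nonneg u.2.1 x)]
      exact Real.rpow_le_one u.2.1 u.2.2 hx
  · rw [integral_map hm.aemeasurable (by fun_prop), integral_congr_ae hexp]
    rcases hx.eq_or_lt with rfl | hx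
    · simp [hf0]
    · exact hQ x hx

/-- The discrete probability measures on `[0, 1]` built from the Taylor coefficients of `f` at
`a`. -/
theorem CompletelyMonotone.exists_unitInterval_approx {f : ℝ → ℝ} (hf : CompletelyMonotone f)
    (hf0 : f 0 = 1) (h0 : Tendsto f (𝓝[>] 0) (𝓝 (f 0))) {a : ℝ} (ha : 0 < a) :
    ∃ Q : ProbabilityMeasure unitInterval, ∀ x, 0 < x →
      ∫ u : unitInterval, (u : ℝ) ^ x ∂(Q : Measure unitInterval) =
        f (a * (1 - Real.exp (-(x / a)))) := by
  set w : ℕ → ℝ := fun k => (-1) ^ k * iteratedDeriv k f a * a ^ k / k ! with hw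
  have hw0 : ∀ k, 0 ≤ w k := fun k => by
    simpa using hf.taylor_term_nonneg ha ha.le k (b := 0)
  have hw1 : HasSum w 1 := hf0 ▸ hf.hasSum_taylor_zero h0 ha
  set p : ℕ → unitInterval := fun k => ⟨Real.exp (-(k / a)), (Real.exp_pos _).le,
    Real.exp_le_one_iff.2 (neg_nonpos.2 (by positivity))⟩ with hp
  set Q : Measure unitInterval :=
    Measure.sum fun k => ENNReal.ofReal (w k) • Measure.dirac (p k) with hQ
  have hprob : IsProbabilityMeasure Q := by
    constructor
    simp only [hQ, Measure.sum_apply _ MeasurableSet.univ, Measure.smul_apply, measure_univ,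
      smul_eq_mul, mul_one]
    rw [← ENNReal.ofReal_tsum_of_nonneg hw0 hw1.summable, hw1.tsum_eq, ENNReal.ofReal_one]
  refine ⟨⟨Q, hprob⟩, fun x hx => ?_⟩
  have hint : Integrable (fun u : unitInterval => (u : ℝ) ^ x) Q := by
    refine Integrable.of_bound (C := 1) (Measurable.aestronglyMeasurable (by fun_prop))
      (ae_of_all _ fun u => ?_)
    rw [Real.norm_of_nonneg (Real.rpow_nonneg u.2.1 x)]
    exact Real.rpow_le_one u.2.1 u.2.2 hx.le
  have hlt : Real.exp (-(x / a)) < 1 := Real.exp_lt_one_iff.2 (neg_neg_of_pos (by positivity))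
  have hT := hf.hasSum_taylor (a := a) (b := a * (1 - Real.exp (-(x / a))))
    (mul_pos ha (sub_pos.2 hlt)) (by nlinarith [Real.exp_pos (-(x / a))])
  refine (hasSum_integral_measure hint).unique ?_
  refine hT.congr_fun fun k => ?_
  rw [integral_smul_measure, integral_dirac, ENNReal.toReal_ofReal (hw0 k), smul_eq_mul]
  have hpow : ((p k : unitInterval) : ℝ) ^ x = Real.exp (-(x / a)) ^ k := by
    rw [← Real.exp_nat_mul, ← Real.exp_mul]
    ring_nf
  rw [hpow, hw, show a - a * (1 - Real.exp (-(x / a))) = a * Real.exp (-(x / a)) by ring, mul_pow]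
  ring

/-- **Bernstein's theorem**: a completely monotone function that is continuous at `0` with value
`1` is the Laplace transform of a probability measure. -/
theorem CompletelyMonotone.exists_laplace {f : ℝ → ℝ} (hf : CompletelyMonotone f)
    (hf0 : f 0 = 1) (h0 : Tendsto f (𝓝[>] 0) (𝓝 (f 0))) :
    ∃ ν : Measure ℝ, IsProbabilityMeasure ν ∧ ∀ x, 0 ≤ x →
      Integrable (fun y => Real.exp (-x * y)) ν ∧ ∫ y, Real.exp (-x * y) ∂ν = f x := by
  choose Q hQ using fun n : ℕ =>
    hf.exists_unitInterval_approx hf0 h0 (a := (n : ℝ) + 1) (by positivity)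
  set L := (Ultrafilter.map Q (hyperfilter ℕ)).lim with hL
  have hlim : Tendsto Q (hyperfilter ℕ) (𝓝 L) := (Ultrafilter.map Q (hyperfilter ℕ)).le_nhds_lim
  refine exists_laplace_of_unitInterval hf0 h0 (L : Measure unitInterval) fun x hx => ?_
  let g : BoundedContinuousFunction unitInterval ℝ := BoundedContinuousFunction.mkOfCompact
    ⟨fun u => (u : ℝ) ^ x, by fun_prop (disch := simp [hx.le])⟩
  have h1 := (ProbabilityMeasure.tendsto_iff_forall_integral_tendsto.1 hlim) g
  refine tendsto_nhds_unique h1 ?_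
  have harg : Tendsto (fun n : ℕ => ((n : ℝ) + 1) * (1 - Real.exp (-(x / ((n : ℝ) + 1)))))
      atTop (𝓝 x) := by
    have hlow : Tendsto (fun n : ℕ => x / (1 + x * (1 / ((n : ℝ) + 1)))) atTop (𝓝 x) := by
      simpa [Pi.div_def] using tendsto_const_nhds.div (((tendsto_one_div_add_atTop_nhds_zero_nat
        (𝕜 := ℝ)).const_mul x).const_add 1) (by simp)
    refine tendsto_of_tendsto_of_tendsto_of_le_of_le hlow tendsto_const_nhds (fun n => ?_)
      fun n => ?_
    · have hn : (0 : ℝ) < (n : ℝ) + 1 := by positivity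
      have h1 : Real.exp (-(x / ((n : ℝ) + 1))) ≤ 1 / (1 + x / ((n : ℝ) + 1)) := by
        rw [Real.exp_neg, ← one_div]
        exact one_div_le_one_div_of_le (by positivity)
          (by linarith [Real.add_one_le_exp (x / ((n : ℝ) + 1))])
      calc x / (1 + x * (1 / ((n : ℝ) + 1)))
          = ((n : ℝ) + 1) * (1 - 1 / (1 + x / ((n : ℝ) + 1))) := by
            field_simp
            ring
        _ ≤ _ := mul_le_mul_of_nonneg_left (by linarith) hn.le
    · have hn : (0 : ℝ) < (n : ℝ) + 1 := by positivity
      calc ((n : ℝ) + 1) * (1 - Real.exp (-(x / ((n : ℝ) + 1))))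
          ≤ ((n : ℝ) + 1) * (x / ((n : ℝ) + 1)) := mul_le_mul_of_nonneg_left
            (by linarith [Real.add_one_le_exp (-(x / ((n : ℝ) + 1)))]) hn.le
        _ = x := by field_simp
  have h2 := ((hf.contDiffAt hx 0).continuousAt.tendsto.comp harg).mono_left
    (Nat.hyperfilter_le_atTop)
  exact h2.congr fun n => (hQ n x hx).symm

/-- If the `n`-th power of the Laplace transform of `ν` is the Laplace transform of `μ`, then `μ` is
the `n`-fold convolution power of `ν`. -/
theorem map_sum_pi_eq_of_laplace_pow_eq {f : ℝ → ℝ} (hf : ∀ x, 0 ≤ x → 0 < f x) {μ ν : Measure ℝ}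
    [IsProbabilityMeasure μ] [IsProbabilityMeasure ν]
    (hμ : ∀ x, 0 ≤ x → ∫ y, Real.exp (-x * y) ∂μ = f x) {n : ℕ}
    (hν : ∀ x, 0 ≤ x → (∫ y, Real.exp (-x * y) ∂ν) ^ n = f x) :
    Measure.map (fun y : Fin n → ℝ => ∑ i, y i) (Measure.pi fun _ => ν) = μ := by
  have hm : Measurable fun y : Fin n → ℝ => ∑ i, y i := by fun_prop
  have := Measure.isProbabilityMeasure_map (μ := Measure.pi fun _ : Fin n => ν) hm.aemeasurable
  have heq : ∀ x, 0 ≤ x → ∫ y, Real.exp (-x * y) ∂Measure.map (fun y : Fin n → ℝ => ∑ i, y i)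
      (Measure.pi fun _ => ν) = f x := by
    intro x hx
    rw [integral_map hm.aemeasurable (by fun_prop)]
    simp_rw [Finset.mul_sum, Real.exp_sum]
    rw [integral_fintype_prod_eq_pow (fun y => Real.exp (-x * y)), Fintype.card_fin, hν x hx]
  have hint : ∀ ρ : Measure ℝ, (∀ x, 0 ≤ x → ∫ y, Real.exp (-x * y) ∂ρ = f x) →
      ∀ x, 0 ≤ x → Integrable (fun y => Real.exp (-x * y)) ρ := fun ρ hρ x hx =>
    Integrable.of_integral_ne_zero (by rw [hρ x hx]; exact (hf x hx).ne')
  exact Measure.ext_of_laplace_eq (hint _ heq) (hint _ hμ) fun x hx => by rw [heq x hx, hμ x hx]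

/-- The integrals `∫₀¹ (1 - s²)ⁿ / (1 + x (1 - s²))ⁿ⁺¹ ds`, which are up to constants the
derivatives of `x ↦ (arsinh √x)²`. -/
noncomputable def arsinhSqIntegral (n : ℕ) (x : ℝ) : ℝ :=
  ∫ s in (0 : ℝ)..1, (1 - s ^ 2) ^ n / (1 + x * (1 - s ^ 2)) ^ (n + 1)

theorem one_le_one_add_mul_one_sub_sq {x s : ℝ} (hx : 0 < x) (hs : s ∈ Icc (0 : ℝ) 1) :
    1 ≤ 1 + x * (1 - s ^ 2) := by
  have : 0 ≤ x * (1 - s ^ 2) := mul_nonneg hx.le (by nlinarith [hs.1, hs.2])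
  linarith

theorem intervalIntegrable_arsinhSqIntegrand (n m : ℕ) {x : ℝ} (hx : 0 < x) :
    IntervalIntegrable (fun s : ℝ => (1 - s ^ 2) ^ n / (1 + x * (1 - s ^ 2)) ^ m) volume 0 1 := by
  refine ContinuousOn.intervalIntegrable fun s hs => ContinuousAt.continuousWithinAt ?_
  rw [uIcc_of_le zero_le_one] at hs
  have := (zero_lt_one.trans_le (one_le_one_add_mul_one_sub_sq hx hs)).ne'
  exact ContinuousAt.div₀ (by fun_prop) (by fun_prop) (pow_ne_zero _ this)

theorem arsinhSqIntegral_nonneg (n : ℕ) {x : ℝ} (hx : 0 < x) : 0 ≤ arsinhSqIntegral n x := by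
  refine intervalIntegral.integral_nonneg zero_le_one fun s hs => ?_
  have h1 := zero_le_one.trans (one_le_one_add_mul_one_sub_sq hx hs)
  have h2 : 0 ≤ 1 - s ^ 2 := by nlinarith [hs.1, hs.2]
  positivity

theorem hasDerivAt_arsinhSqIntegral (n : ℕ) {x : ℝ} (hx : 0 < x) :
    HasDerivAt (arsinhSqIntegral n) (-((n + 1) * arsinhSqIntegral (n + 1) x)) x := by
  have hval : -((n + 1) * arsinhSqIntegral (n + 1) x) = ∫ s in (0 : ℝ)..1,
      -((n + 1) * ((1 - s ^ 2) ^ (n + 1) / (1 + x * (1 - s ^ 2)) ^ (n + 2))) := by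
    rw [intervalIntegral.integral_neg, intervalIntegral.integral_const_mul, arsinhSqIntegral]
  rw [hval]
  have hmem : ∀ s : ℝ, s ∈ uIoc (0 : ℝ) 1 → s ∈ Icc (0 : ℝ) 1 := fun s hs => by
    rw [uIoc_of_le zero_le_one] at hs; exact Ioc_subset_Icc_self hs
  refine (intervalIntegral.hasDerivAt_integral_of_dominated_loc_of_deriv_le (s := Ioi 0)
    (bound := fun _ => (n : ℝ) + 1) (F' := fun x s =>
      -((n + 1) * ((1 - s ^ 2) ^ (n + 1) / (1 + x * (1 - s ^ 2)) ^ (n + 2))))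
    (Ioi_mem_nhds hx) ?_ (intervalIntegrable_arsinhSqIntegrand n (n + 1) hx) ?_ ?_
    intervalIntegrable_const ?_).2
  · exact Eventually.of_forall fun y => Measurable.aestronglyMeasurable (by fun_prop)
  · exact Measurable.aestronglyMeasurable (by fun_prop)
  · refine ae_of_all _ fun s hs y hy => ?_
    have h1 := one_le_one_add_mul_one_sub_sq hy (hmem s hs)
    have h2 : 0 ≤ 1 - s ^ 2 := by nlinarith [(hmem s hs).1, (hmem s hs).2]
    have h3 : (1 - s ^ 2) ^ (n + 1) ≤ 1 := pow_le_one₀ h2 (by nlinarith)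
    have h4 : 1 ≤ (1 + y * (1 - s ^ 2)) ^ (n + 2) := one_le_pow₀ h1
    have h5 : (1 - s ^ 2) ^ (n + 1) / (1 + y * (1 - s ^ 2)) ^ (n + 2) ≤ 1 :=
      (div_le_one (by linarith)).2 (h3.trans h4)
    rw [norm_neg, Real.norm_of_nonneg (by positivity)]
    exact mul_le_of_le_one_right (by positivity) h5
  · refine ae_of_all _ fun s hs y hy => ?_
    have h1 := (zero_lt_one.trans_le (one_le_one_add_mul_one_sub_sq hy (hmem s hs))).ne'
    have hd : HasDerivAt (fun y : ℝ => 1 + y * (1 - s ^ 2)) (1 - s ^ 2) y := by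
      simpa using ((hasDerivAt_id y).mul_const (1 - s ^ 2)).const_add 1
    refine ((hasDerivAt_const y ((1 - s ^ 2) ^ n)).fun_div (hd.fun_pow (n + 1))
      (pow_ne_zero _ h1)).congr_deriv ?_
    push_cast
    field_simp
    ring

theorem completelyMonotone_arsinhSqIntegral (n : ℕ) : CompletelyMonotone (arsinhSqIntegral n) := by
  intro N
  induction N generalizing n with
  | zero =>
    exact CompletelyMonotoneUpTo.zero_iff.2
      ⟨fun x hx => (hasDerivAt_arsinhSqIntegral n hx).continuousAt.continuousWithinAt,
        fun x hx => arsinhSqIntegral_nonneg n hx⟩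
  | succ N ih =>
    exact ((CompletelyMonotoneUpTo.const (r := (n : ℝ) + 1) (by positivity)).mul
      (ih (n + 1))).succ_of_hasDerivAt (fun x hx => arsinhSqIntegral_nonneg n hx)
      fun x hx => hasDerivAt_arsinhSqIntegral n hx

theorem arsinhSqIntegral_zero {x : ℝ} (hx : 0 < x) :
    arsinhSqIntegral 0 x = arsinh (√x) / (√x * √(1 + x)) := by
  have hp : 0 < √x := Real.sqrt_pos.2 hx
  have hq : 0 < √(1 + x) := Real.sqrt_pos.2 (by linarith)
  have hpq : √x < √(1 + x) := Real.sqrt_lt_sqrt hx.le (by linarith)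
  have hp2 : √x ^ 2 = x := Real.sq_sqrt hx.le
  have hq2 : √(1 + x) ^ 2 = 1 + x := Real.sq_sqrt (by linarith)
  have harsinh : arsinh (√x) = Real.log (√x + √(1 + x)) := by rw [arsinh, hp2]
  rw [harsinh]
  generalize √x = p at *
  generalize √(1 + x) = q at *
  have hderiv : ∀ s ∈ uIcc (0 : ℝ) 1,
      HasDerivAt (fun s => (Real.log (q + s * p) - Real.log (q - s * p)) / (2 * (p * q)))
        ((1 - s ^ 2) ^ 0 / (1 + x * (1 - s ^ 2)) ^ (0 + 1)) s := by
    intro s hs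
    rw [uIcc_of_le zero_le_one] at hs
    have h1 : 0 < q + s * p := by nlinarith [hs.1]
    have h2 : 0 < q - s * p := by nlinarith [hs.2]
    have hd1 : HasDerivAt (fun s : ℝ => q + s * p) p s := by
      simpa using ((hasDerivAt_id s).mul_const p).const_add q
    have hd2 : HasDerivAt (fun s : ℝ => q - s * p) (-p) s := by
      simpa using ((hasDerivAt_id s).mul_const p).const_sub q
    refine (((hd1.log h1.ne').fun_sub (hd2.log h2.ne')).div_const (2 * (p * q))).congr_deriv ?_
    have h3 : 1 + x * (1 - s ^ 2) = (q + s * p) * (q - s * p) := by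
      linear_combination (-1) * hq2 + s ^ 2 * hp2
    rw [h3]
    have h1' := h1.ne'
    have h2' := h2.ne'
    rw [zero_add, pow_one, pow_zero, div_sub_div _ _ h1' h2', div_div, div_eq_div_iff
      (by positivity) (by positivity)]
    ring
  rw [arsinhSqIntegral, intervalIntegral.integral_eq_sub_of_hasDerivAt hderiv
    (intervalIntegrable_arsinhSqIntegrand 0 (0 + 1) hx)]
  have hinv : q - p = (p + q)⁻¹ := by
    refine eq_inv_of_mul_eq_one_left ?_
    linear_combination hq2 - hp2
  simp only [one_mul, zero_mul, add_zero, sub_zero, sub_self, zero_div]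
  rw [hinv, Real.log_inv, add_comm q p]
  field_simp
  ring

theorem hasDerivAt_arsinh_sqrt_sq {x : ℝ} (hx : 0 < x) :
    HasDerivAt (fun x => arsinh (√x) ^ 2) (arsinhSqIntegral 0 x) x := by
  refine (((Real.hasDerivAt_sqrt hx.ne').arsinh).fun_pow 2).congr_deriv ?_
  rw [arsinhSqIntegral_zero hx, Real.sq_sqrt hx.le, smul_eq_mul]
  have hp : 0 < √x := Real.sqrt_pos.2 hx
  have hq : 0 < √(1 + x) := Real.sqrt_pos.2 (by linarith)
  push_cast
  field_simp

/-- The derivative of the exponent `log (1 + x) / 2 + log (1 + (arsinh √x)² / c²)`. -/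
noncomputable def psiDeriv (c x : ℝ) : ℝ :=
  1 / 2 * (1 + x)⁻¹ + arsinhSqIntegral 0 x * (c ^ 2 + arsinh (√x) ^ 2)⁻¹

theorem completelyMonotone_psiDeriv {c : ℝ} (hc : 0 < c) : CompletelyMonotone (psiDeriv c) := by
  have h1 : CompletelyMonotone fun x => (1 + x)⁻¹ :=
    CompletelyMonotone.inv (g := fun _ => 1) (fun N => .const zero_le_one)
      (fun x hx => by linarith) fun x _ => (hasDerivAt_id x).const_add 1
  have h2 : CompletelyMonotone fun x => (c ^ 2 + arsinh (√x) ^ 2)⁻¹ :=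
    (completelyMonotone_arsinhSqIntegral 0).inv (fun x _ => by positivity)
      fun x hx => (hasDerivAt_arsinh_sqrt_sq hx).const_add _
  exact fun N => ((CompletelyMonotoneUpTo.const (by norm_num)).mul (h1 N)).add
    ((completelyMonotone_arsinhSqIntegral 0 N).mul (h2 N))

theorem hasDerivAt_psi {c x : ℝ} (hc : 0 < c) (hx : 0 < x) :
    HasDerivAt (fun x => 1 / 2 * Real.log (1 + x) + Real.log (1 + arsinh (√x) ^ 2 / c ^ 2))
      (psiDeriv c x) x := by
  have h1 : HasDerivAt (fun x : ℝ => 1 + x) 1 x := (hasDerivAt_id x).const_add 1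
  have h2 := ((hasDerivAt_arsinh_sqrt_sq hx).div_const (c ^ 2)).const_add 1
  have hne : (1 + arsinh (√x) ^ 2 / c ^ 2) ≠ 0 := by positivity
  refine (((h1.log (by linarith)).const_mul (1 / 2)).fun_add (h2.log hne)).congr_deriv ?_
  rw [psiDeriv]
  field_simp

theorem psi_one_is_bernstein_and_infinitely_divisible
    (c : ℝ) (hc : 0 < c)
    (ψ : ℝ → ℝ)
    (hψ : ∀ x : ℝ, ψ x = (1 / 2) * Real.log (1 + x) +
        Real.log (1 + (Real.arsinh (Real.sqrt x)) ^ 2 / c ^ 2)) :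
    ψ 0 = 0 ∧
    (∀ x : ℝ, 0 ≤ x → 0 ≤ ψ x) ∧
    ContDiffOn ℝ (⊤ : ℕ∞) ψ (Set.Ioi 0) ∧
    (∀ n : ℕ, 1 ≤ n → ∀ x : ℝ, 0 < x →
      0 ≤ (-1 : ℝ) ^ (n - 1) * iteratedDeriv n ψ x) ∧
    (∀ μ : Measure ℝ, IsProbabilityMeasure μ →
      (∀ x : ℝ, 0 ≤ x → ∫ y, Real.exp (-x * y) ∂μ = Real.exp (-ψ x)) →
      ∀ n : ℕ, 0 < n → ∃ ν : Measure ℝ, IsProbabilityMeasure ν ∧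
        Measure.map (fun y : Fin n → ℝ => ∑ i, y i) (Measure.pi fun _ => ν) = μ) := by
  have hd : ∀ x, 0 < x → HasDerivAt ψ (psiDeriv c x) x := fun x hx =>
    funext hψ ▸ hasDerivAt_psi hc hx
  have hcm := completelyMonotone_psiDeriv hc
  have heq : EqOn (deriv ψ) (psiDeriv c) (Ioi 0) := fun x hx => (hd x hx).deriv
  have h0 : ψ 0 = 0 := by simp [hψ]
  refine ⟨h0, fun x hx => ?_, ?_, fun n hn x hx => ?_, fun μ hμ hL n hn => ?_⟩
  · rw [hψ]
    have h1 := Real.log_nonneg (show 1 ≤ 1 + x by linarith)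
    have h2 := Real.log_nonneg (show 1 ≤ 1 + arsinh (√x) ^ 2 / c ^ 2 from
      le_add_of_nonneg_right (by positivity))
    linarith
  · rw [contDiffOn_infty_iff_deriv_of_isOpen isOpen_Ioi]
    exact ⟨fun x hx => (hd x hx).differentiableAt.differentiableWithinAt,
      contDiffOn_infty.2 fun N => (hcm N).contDiffOn.congr heq⟩
  · obtain ⟨m, rfl⟩ := Nat.exists_eq_add_of_le' hn
    have h : deriv ψ =ᶠ[𝓝 x] psiDeriv c := heq.eventuallyEq_of_mem (Ioi_mem_nhds hx)
    rw [iteratedDeriv_succ', h.iteratedDeriv_eq, Nat.add_sub_cancel]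
    exact (hcm m).nonneg m le_rfl x hx
  · have hroot : CompletelyMonotone fun x => Real.exp (-(1 / (n : ℝ) * ψ x)) :=
      CompletelyMonotone.exp_neg (g := fun x => 1 / (n : ℝ) * psiDeriv c x)
        (fun N => (CompletelyMonotoneUpTo.const (by positivity)).mul (hcm N))
        fun x hx => (hd x hx).const_mul _
    have hcont : ContinuousAt ψ 0 := by
      rw [funext hψ]
      refine ContinuousAt.add (continuousAt_const.mul (ContinuousAt.log (by fun_prop) (by simp)))
        (ContinuousAt.log ?_ (by simp))
      exact ((((Real.continuous_arsinh.comp Real.continuous_sqrt).pow 2).div_const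
        _).const_add 1).continuousAt
    have htendsto : Tendsto (fun x => Real.exp (-(1 / (n : ℝ) * ψ x))) (𝓝[>] 0)
        (𝓝 (Real.exp (-(1 / (n : ℝ) * ψ 0)))) :=
      ((hcont.tendsto.const_mul _).neg.rexp).mono_left nhdsWithin_le_nhds
    obtain ⟨ν, hν, hνL⟩ := hroot.exists_laplace (by simp [h0]) htendsto
    refine ⟨ν, hν,
      map_sum_pi_eq_of_laplace_pow_eq (fun x _ => Real.exp_pos (-ψ x)) hL fun x hx => ?_⟩
    rw [(hνL x hx).2, ← Real.exp_nat_mul]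
    congr 1
    field_simp
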